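/- Interior gradient estimate: for C ∈ ℝ let Ω_C := {x ∈ Δ : w(x) < C}. For every N ∈ ℕ there exists a constant K(N) > 0 such that for every n ≥ N + 10 and every C^∞ function u : Ω_n → ℝ with everywhere positive definite Hessian that satisfies u(x) = log det(½∇²u(x)) for all x ∈ Ω_n and w(x) − log(d+1) ≤ u(x) ≤ w(x) for all x ∈ Ω_n, one has |∇u(x)| ≤ K(N) for every x ∈ Ω_N. -/

import Mathlib

open Real Filter MeasureTheory
open scoped Matrix

noncomputable section

/-- The open subprobability simplex in `ℝ^d`. -/
def simplexΔ (d : ℕ) : Set (Fin d → ℝ) := {x | (∀ i, 0 < x i) ∧ ∑ i, x i < 1}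

/-- Hessian matrix of `u` at `x` (entries `∂²u/∂xᵢ∂xⱼ`). -/
def hess (d : ℕ) (u : (Fin d → ℝ) → ℝ) (x : Fin d → ℝ) : Matrix (Fin d) (Fin d) ℝ :=
  Matrix.of fun i j => fderiv ℝ (fun y => fderiv ℝ u y (Pi.single j 1)) x (Pi.single i 1)

/-- The barrier function `w(x) = -2∑ log xᵢ - 2 log(1-∑xᵢ)`. -/
def wbar (d : ℕ) (x : Fin d → ℝ) : ℝ :=
  -2 * ∑ i, Real.log (x i) - 2 * Real.log (1 - ∑ i, x i)

/-- Gradient of `u` at `x`. -/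
def gradv (d : ℕ) (u : (Fin d → ℝ) → ℝ) (x : Fin d → ℝ) : Fin d → ℝ :=
  fun i => fderiv ℝ u x (Pi.single i 1)

/-- Derivative bound at the centre of an interval for a convex function of one variable. -/
lemma abs_deriv_le_of_deriv2_nonneg {g g₁ g₂ : ℝ → ℝ} {δ A B : ℝ} (hδ : 0 < δ)
    (h₁ : ∀ t ∈ Set.Icc (-δ) δ, HasDerivAt g (g₁ t) t)
    (h₂ : ∀ t ∈ Set.Icc (-δ) δ, HasDerivAt g₁ (g₂ t) t)
    (hg₂ : ∀ t ∈ Set.Icc (-δ) δ, 0 ≤ g₂ t)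
    (hB : ∀ t ∈ Set.Icc (-δ) δ, g t ≤ B) (hA : A ≤ g 0) :
    |g₁ 0| ≤ (B - A) / δ := by
  have hmono : MonotoneOn g₁ (Set.Icc (-δ) δ) := by
    refine monotoneOn_of_hasDerivWithinAt_nonneg (f' := g₂) (convex_Icc _ _)
      (fun t ht => (h₂ t ht).continuousAt.continuousWithinAt) ?_ ?_
    · exact fun t ht => (h₂ t (interior_subset ht)).hasDerivWithinAt
    · exact fun t ht => hg₂ t (interior_subset ht)
  have hmem {t : ℝ} (ha : -δ ≤ t) (hb : t ≤ δ) : t ∈ Set.Icc (-δ) δ := ⟨ha, hb⟩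
  obtain ⟨c, hc, hcs⟩ := exists_hasDerivAt_eq_slope g g₁ hδ
    (fun t ht => (h₁ t (hmem (by linarith [ht.1]) ht.2)).continuousAt.continuousWithinAt)
    (fun t ht => h₁ t (hmem (by linarith [ht.1]) ht.2.le))
  obtain ⟨b, hb, hbs⟩ := exists_hasDerivAt_eq_slope g g₁ (neg_lt_zero.2 hδ)
    (fun t ht => (h₁ t (hmem ht.1 (by linarith [ht.2]))).continuousAt.continuousWithinAt)
    (fun t ht => h₁ t (hmem ht.1.le (by linarith [ht.2])))
  have h0c := hmono (hmem (by linarith) hδ.le) (hmem (by linarith [hc.1]) hc.2.le) hc.1.le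
  have hb0 := hmono (hmem hb.1.le (by linarith [hb.2])) (hmem (by linarith) hδ.le) hb.2.le
  have hBδ := hB δ (hmem (by linarith) le_rfl)
  have hBδ' := hB (-δ) (hmem le_rfl (by linarith))
  rw [sub_zero] at hcs
  rw [zero_sub, neg_neg] at hbs
  rw [abs_le, ← neg_div]
  constructor
  · refine le_trans ?_ hb0
    rw [hbs]
    gcongr
    linarith
  · refine h0c.trans ?_
    rw [hcs]
    gcongr

lemma isOpen_simplexΔ (d : ℕ) : IsOpen (simplexΔ d) := by
  have h : simplexΔ d = (⋂ i, {x | 0 < x i}) ∩ {x | ∑ i, x i < 1} := by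
    ext x
    simp [simplexΔ]
  rw [h]
  exact (isOpen_iInter_of_finite fun i => isOpen_lt continuous_const (continuous_apply i)).inter
    (isOpen_lt (by fun_prop) continuous_const)

lemma isOpen_wbar_sublevel (d : ℕ) (C : ℝ) : IsOpen {x ∈ simplexΔ d | wbar d x < C} := by
  have hc : ContinuousOn (wbar d) (simplexΔ d) := by
    unfold wbar
    refine ContinuousOn.sub (continuousOn_const.mul (continuousOn_finsetSum _ fun i _ => ?_))
      (continuousOn_const.mul ?_)
    · exact (continuous_apply i).continuousOn.log fun x hx => (hx.1 i).ne'
    · exact ContinuousOn.log (by fun_prop) fun x hx => (sub_pos.2 hx.2).ne'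
  exact hc.isOpen_inter_preimage (isOpen_simplexΔ d) isOpen_Iio

lemma lt_one_of_mem_simplexΔ {d : ℕ} {x : Fin d → ℝ} (hx : x ∈ simplexΔ d) (i : Fin d) :
    x i < 1 :=
  (Finset.single_le_sum (fun j _ => (hx.1 j).le) (Finset.mem_univ i)).trans_lt hx.2

lemma sum_log_nonpos {d : ℕ} {x : Fin d → ℝ} (hx : x ∈ simplexΔ d) :
    ∑ i, Real.log (x i) ≤ 0 :=
  Finset.sum_nonpos fun i _ => Real.log_nonpos (hx.1 i).le (lt_one_of_mem_simplexΔ hx i).le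

lemma log_one_sub_sum_nonpos {d : ℕ} {x : Fin d → ℝ} (hx : x ∈ simplexΔ d) :
    Real.log (1 - ∑ i, x i) ≤ 0 :=
  Real.log_nonpos (sub_pos.2 hx.2).le
    (by linarith [Finset.sum_nonneg fun i (_ : i ∈ Finset.univ) => (hx.1 i).le])

lemma wbar_nonneg {d : ℕ} {x : Fin d → ℝ} (hx : x ∈ simplexΔ d) : 0 ≤ wbar d x := by
  unfold wbar
  linarith [sum_log_nonpos hx, log_one_sub_sum_nonpos hx]

lemma exp_lt_apply_of_wbar_lt {d : ℕ} {x : Fin d → ℝ} (hx : x ∈ simplexΔ d) {C : ℝ}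
    (h : wbar d x < C) (i : Fin d) : Real.exp (-C / 2) < x i := by
  rw [← Real.lt_log_iff_exp_lt (hx.1 i)]
  have h₁ : ∑ j, Real.log (x j) ≤ Real.log (x i) := by
    rw [← Finset.add_sum_erase _ _ (Finset.mem_univ i)]
    linarith [Finset.sum_nonpos fun j (_ : j ∈ Finset.univ.erase i) =>
      Real.log_nonpos (hx.1 j).le (lt_one_of_mem_simplexΔ hx j).le]
  unfold wbar at h
  linarith [log_one_sub_sum_nonpos hx]

lemma exp_lt_one_sub_sum_of_wbar_lt {d : ℕ} {x : Fin d → ℝ} (hx : x ∈ simplexΔ d) {C : ℝ}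
    (h : wbar d x < C) : Real.exp (-C / 2) < 1 - ∑ i, x i := by
  rw [← Real.lt_log_iff_exp_lt (sub_pos.2 hx.2)]
  unfold wbar at h
  linarith [sum_log_nonpos hx]

lemma log_sub_log_two_le_log_add {a t : ℝ} (ha : 0 < a) (h : -(a / 2) ≤ t) :
    Real.log a - Real.log 2 ≤ Real.log (a + t) := by
  rw [← Real.log_div ha.ne' two_ne_zero]
  exact Real.log_le_log (by positivity) (by linarith)

/-- Moving along a coordinate axis by at most half the distance to the faces of the simplex
increases the barrier by at most `4 log 2 < 4`. -/
lemma add_smul_single_mem_sublevel {d : ℕ} {x : Fin d → ℝ} (hx : x ∈ simplexΔ d) {C : ℝ}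
    (h : wbar d x < C) (i : Fin d) {t : ℝ} (ht : |t| ≤ Real.exp (-C / 2) / 2) :
    x + t • Pi.single i 1 ∈ {y ∈ simplexΔ d | wbar d y < C + 4} := by
  have hi := exp_lt_apply_of_wbar_lt hx h i
  have hs := exp_lt_one_sub_sum_of_wbar_lt hx h
  have hpos := Real.exp_pos (-C / 2)
  obtain ⟨ht₁, ht₂⟩ := abs_le.1 ht
  have hsum : ∑ j, (x + t • Pi.single i 1 : Fin d → ℝ) j = ∑ j, x j + t := by
    simp [Finset.sum_add_distrib, ← Finset.mul_sum]
  have hself : (x + t • Pi.single i 1 : Fin d → ℝ) i = x i + t := by simp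
  have hne : ∀ j, j ≠ i → (x + t • Pi.single i 1 : Fin d → ℝ) j = x j := by
    intro j hj
    simp [hj]
  refine ⟨⟨fun j => ?_, ?_⟩, ?_⟩
  · by_cases hj : j = i
    · subst hj
      rw [hself]
      linarith
    · rw [hne j hj]
      exact hx.1 j
  · rw [hsum]
    linarith
  · have h₁ := log_sub_log_two_le_log_add (hx.1 i) (t := t) (by linarith)
    have h₂ := log_sub_log_two_le_log_add (sub_pos.2 hx.2) (t := -t) (by linarith)
    have hlog := Real.log_two_lt_d9
    unfold wbar at h ⊢
    rw [hsum, ← Finset.add_sum_erase _ _ (Finset.mem_univ i), hself,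
      Finset.sum_congr rfl fun j hj => by rw [hne j (Finset.ne_of_mem_erase hj)]]
    rw [← Finset.add_sum_erase _ _ (Finset.mem_univ i)] at h
    rw [show 1 - (∑ j, x j + t) = 1 - ∑ j, x j + -t by ring]
    linarith

lemma hasDerivAt_comp_line {E : Type*} [NormedAddCommGroup E] [NormedSpace ℝ E] {f : E → ℝ}
    {x v : E} {t : ℝ} (hf : DifferentiableAt ℝ f (x + t • v)) :
    HasDerivAt (fun s : ℝ => f (x + s • v)) (fderiv ℝ f (x + t • v) v) t := by
  have hl : HasDerivAt (fun s : ℝ => x + s • v) v t := by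
    simpa using ((hasDerivAt_id t).smul_const v).const_add x
  exact hf.hasFDerivAt.comp_hasDerivAt t hl

/-- Interior gradient estimate on sublevel sets of the barrier function. -/
theorem interior_gradient_estimate (d : ℕ) (hd : 1 ≤ d) (N : ℕ) :
    ∃ K > (0 : ℝ), ∀ n : ℕ, N + 10 ≤ n →
      ∀ u : (Fin d → ℝ) → ℝ,
        ContDiffOn ℝ (⊤ : ℕ∞) u {x ∈ simplexΔ d | wbar d x < (n : ℝ)} →
        (∀ x ∈ {x ∈ simplexΔ d | wbar d x < (n : ℝ)}, (hess d u x).PosDef) →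
        (∀ x ∈ {x ∈ simplexΔ d | wbar d x < (n : ℝ)},
          u x = Real.log (((2 : ℝ)⁻¹ • hess d u x).det)) →
        (∀ x ∈ {x ∈ simplexΔ d | wbar d x < (n : ℝ)},
          wbar d x - Real.log ((d : ℝ) + 1) ≤ u x ∧ u x ≤ wbar d x) →
        ∀ x ∈ {x ∈ simplexΔ d | wbar d x < (N : ℝ)},
          Real.sqrt (∑ i, gradv d u x i ^ 2) ≤ K := by
  set δ : ℝ := Real.exp (-N / 2) / 2 with hδ
  set M : ℝ := ((N : ℝ) + 4 + Real.log ((d : ℝ) + 1)) / δ with hM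
  have hδ0 : 0 < δ := by positivity
  refine ⟨Real.sqrt (d * M ^ 2) + 1, by positivity, ?_⟩
  intro n hn u hu hpd _ hbd x hx
  set Ω := {x ∈ simplexΔ d | wbar d x < (n : ℝ)}
  have hΩ : IsOpen Ω := isOpen_wbar_sublevel d n
  have hNn : (N : ℝ) + 10 ≤ n := by exact_mod_cast hn
  have hcoord (i : Fin d) : |gradv d u x i| ≤ M := by
    have hline : ∀ t ∈ Set.Icc (-δ) δ,
        x + t • Pi.single i 1 ∈ {y ∈ simplexΔ d | wbar d y < (N : ℝ) + 4} :=
      fun t ht => add_smul_single_mem_sublevel hx.1 hx.2 i (abs_le.2 ht)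
    have hmem : ∀ t ∈ Set.Icc (-δ) δ, x + t • Pi.single i 1 ∈ Ω :=
      fun t ht => ⟨(hline t ht).1, (hline t ht).2.trans (by linarith)⟩
    have hxΩ : x ∈ Ω := ⟨hx.1, hx.2.trans (by linarith)⟩
    have hsmooth : ∀ y ∈ Ω, ContDiffAt ℝ (⊤ : ℕ∞) u y :=
      fun y hy => hu.contDiffAt (hΩ.mem_nhds hy)
    have key := abs_deriv_le_of_deriv2_nonneg (g := fun t : ℝ => u (x + t • Pi.single i 1))
      (g₁ := fun t : ℝ => fderiv ℝ u (x + t • Pi.single i 1) (Pi.single i 1))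
      (g₂ := fun t : ℝ => hess d u (x + t • Pi.single i 1) i i)
      (A := -Real.log ((d : ℝ) + 1)) (B := (N : ℝ) + 4) hδ0
      (fun t ht => hasDerivAt_comp_line
        ((hsmooth _ (hmem t ht)).differentiableAt (by simp)))
      (fun t ht => hasDerivAt_comp_line (f := fun y => fderiv ℝ u y (Pi.single i 1))
        ((((hsmooth _ (hmem t ht)).fderiv_right (m := 1)
          (WithTop.coe_le_coe.2 (le_top : (1 + 1 : ℕ∞) ≤ ⊤))).differentiableAt (by simp)).clm_apply
            (differentiableAt_const _)))
      (fun t ht => (hpd _ (hmem t ht)).diag_pos.le)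
      (fun t ht => (hbd _ (hmem t ht)).2.trans (hline t ht).2.le)
      (by
        have := (hbd x hxΩ).1
        have := wbar_nonneg hx.1
        simp only [zero_smul, add_zero]
        linarith)
    simpa [hM, gradv] using key
  have hsq : ∑ i, gradv d u x i ^ 2 ≤ d * M ^ 2 := by
    have := Finset.sum_le_card_nsmul Finset.univ (fun i => gradv d u x i ^ 2) (M ^ 2)
      fun i _ => sq_le_sq' (abs_le.1 (hcoord i)).1 (abs_le.1 (hcoord i)).2
    simpa using this
  linarith [Real.sqrt_le_sqrt hsq]
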